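/- Let g and k be positive integers with 3k ≤ g, and let A ∈ 𝒜_k. Then the number of numerical semigroups with genus g and type (A; k) is exactly the Fibonacci number F_{g − |(A + A) ∩ [0, k]| + |A| − k − 1}. -/

import Mathlib

open Pointwise

/-- A numerical semigroup: a set of nonnegative integers containing `0`,
closed under addition, with finite complement in `ℕ`. -/
def IsNumericalSemigroup (Λ : Set ℕ) : Prop :=
  0 ∈ Λ ∧ (∀ a ∈ Λ, ∀ b ∈ Λ, a + b ∈ Λ) ∧ (Λᶜ).Finite

/-- The multiplicity `m(Λ)`: the smallest nonzero element of `Λ`. -/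
noncomputable def mult (Λ : Set ℕ) : ℕ := sInf {n | n ∈ Λ ∧ n ≠ 0}

/-- The Frobenius number `f(Λ)`: the largest nonnegative integer not in `Λ`. -/
noncomputable def frob (Λ : Set ℕ) : ℕ := sSup Λᶜ

/-- The genus `g(Λ)`: the number of nonnegative integers not in `Λ`. -/
noncomputable def genus (Λ : Set ℕ) : ℕ := Λᶜ.ncard

/-- Fibonacci numbers indexed by `ℤ`, with `F_n = 0` for `n ≤ 0`,
`F_1 = F_2 = 1`, `F_{n+2} = F_{n+1} + F_n`. -/
def fibZ (n : ℤ) : ℕ := if 0 < n then Nat.fib n.toNat else 0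

/-- Binomial coefficient `C(a, b)` for integers, interpreted as `0` unless `0 ≤ b ≤ a`. -/
def chooseZ (a b : ℤ) : ℕ := if 0 ≤ b ∧ b ≤ a then a.toNat.choose b.toNat else 0

/-- `𝒜_k`: the collection of subsets `A ⊆ [0, k-1]` with `0 ∈ A` and `k ∉ A + A`. -/
def AkSet (k : ℕ) : Finset (Finset ℕ) :=
  (Finset.range k).powerset.filter (fun A => 0 ∈ A ∧ k ∉ A + A)

/-- A numerical semigroup `Λ` (with multiplicity `m = m(Λ)`) has type `(A; k)` if
`f(Λ) = 2m + k` and `Λ ∩ [m, m+k] = A + m`. -/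
noncomputable def HasType (Λ : Set ℕ) (k : ℕ) (A : Finset ℕ) : Prop :=
  frob Λ = 2 * mult Λ + k ∧
    Λ ∩ Set.Icc (mult Λ) (mult Λ + k) = (fun a => a + mult Λ) '' (A : Set ℕ)

/-- `t_g`: the number of numerical semigroups of genus `g` with `f < 3m`. -/
noncomputable def tCount (g : ℕ) : ℕ :=
  {Λ : Set ℕ | IsNumericalSemigroup Λ ∧ genus Λ = g ∧ frob Λ < 3 * mult Λ}.ncard

/-- `n_g`: the number of numerical semigroups of genus `g`. -/
noncomputable def nCount (g : ℕ) : ℕ :=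
  {Λ : Set ℕ | IsNumericalSemigroup Λ ∧ genus Λ = g}.ncard


/-- The gaps shared by all numerical semigroups of type `(A; k)` and multiplicity `m`. -/
def forcedGaps (k : ℕ) (A : Finset ℕ) (m : ℕ) : Finset ℕ :=
  Finset.Ico 1 m ∪ (Finset.range (k + 1) \ A).image (· + m) ∪ {2 * m + k}

/-- The positions where a numerical semigroup of type `(A; k)` and multiplicity `m`
may or may not have a gap. -/
def freePositions (k : ℕ) (A : Finset ℕ) (m : ℕ) : Finset ℕ :=
  Finset.Ioo (m + k) (2 * m) ∪ (Finset.range k \ (A + A)).image (· + 2 * m)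

/-- The set whose gaps are the forced ones and the elements of `T`. -/
def withGaps (k : ℕ) (A : Finset ℕ) (m : ℕ) (T : Finset ℕ) : Set ℕ :=
  (↑(forcedGaps k A m ∪ T))ᶜ

lemma mem_forcedGaps {k m x : ℕ} {A : Finset ℕ} :
    x ∈ forcedGaps k A m ↔
      (1 ≤ x ∧ x < m) ∨ (m ≤ x ∧ x ≤ m + k ∧ x - m ∉ A) ∨ x = 2 * m + k := by
  simp only [forcedGaps, Finset.mem_union, Finset.mem_Ico, Finset.mem_image, Finset.mem_sdiff,
    Finset.mem_range, Finset.mem_singleton, or_assoc]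
  refine or_congr_right (or_congr_left ⟨?_, fun ⟨h₁, h₂, h₃⟩ => ⟨x - m, ⟨by omega, h₃⟩, by omega⟩⟩)
  rintro ⟨y, ⟨hy, hyA⟩, rfl⟩
  exact ⟨by omega, by omega, by simpa using hyA⟩

lemma mem_freePositions {k m x : ℕ} {A : Finset ℕ} :
    x ∈ freePositions k A m ↔
      (m + k < x ∧ x < 2 * m) ∨ (2 * m ≤ x ∧ x < 2 * m + k ∧ x - 2 * m ∉ A + A) := by
  simp only [freePositions, Finset.mem_union, Finset.mem_Ioo, Finset.mem_image, Finset.mem_sdiff,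
    Finset.mem_range]
  refine or_congr_right ⟨?_, fun ⟨h₁, h₂, h₃⟩ => ⟨x - 2 * m, ⟨by omega, h₃⟩, by omega⟩⟩
  rintro ⟨y, ⟨hy, hyA⟩, rfl⟩
  exact ⟨by omega, by omega, by simpa using hyA⟩

lemma mem_withGaps {k m x : ℕ} {A T : Finset ℕ} :
    x ∈ withGaps k A m T ↔ x ∉ forcedGaps k A m ∧ x ∉ T := by
  simp [withGaps]

lemma mem_AkSet {k : ℕ} {A : Finset ℕ} :
    A ∈ AkSet k ↔ A ⊆ Finset.range k ∧ 0 ∈ A ∧ k ∉ A + A := by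
  simp [AkSet]

section Construction

variable {k m : ℕ} {A T : Finset ℕ}

lemma disjoint_forcedGaps_freePositions (hkm : k < m) :
    Disjoint (forcedGaps k A m) (freePositions k A m) := by
  rw [Finset.disjoint_left]
  intro x hx hx'
  rw [mem_forcedGaps] at hx
  rw [mem_freePositions] at hx'
  omega

lemma card_forcedGaps (hkm : k < m) (hA : A ∈ AkSet k) :
    (forcedGaps k A m).card + A.card = m + k + 1 := by
  obtain ⟨hAk, -, -⟩ := mem_AkSet.1 hA
  have hsub : A ⊆ Finset.range (k + 1) := hAk.trans (Finset.range_mono k.le_succ)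
  have hcard := Finset.card_sdiff_add_card_eq_card hsub
  rw [forcedGaps, Finset.card_union_of_disjoint, Finset.card_union_of_disjoint,
    Finset.card_image_of_injective _ (add_left_injective m), Nat.card_Ico, Finset.card_singleton]
  · rw [Finset.card_range] at hcard
    omega
  · simp only [Finset.disjoint_left, Finset.mem_Ico, Finset.mem_image, not_exists]
    omega
  · simp only [Finset.disjoint_singleton_right, Finset.mem_union, Finset.mem_Ico,
      Finset.mem_image, Finset.mem_sdiff, Finset.mem_range]
    rintro (h | ⟨y, ⟨h, -⟩, h'⟩) <;> omega

lemma filter_le_subset_range (hA : A ∈ AkSet k) :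
    (A + A).filter (fun x => x ≤ k) ⊆ Finset.range k := by
  intro x hx
  rw [Finset.mem_filter] at hx
  have : x ≠ k := fun h => (mem_AkSet.1 hA).2.2 (h ▸ hx.1)
  exact Finset.mem_range.2 (by omega)

lemma card_freePositions (hkm : k < m) (hA : A ∈ AkSet k) :
    (freePositions k A m).card + ((A + A).filter (fun x => x ≤ k)).card = m - 1 := by
  have hsdiff : Finset.range k \ (A + A) =
      Finset.range k \ (A + A).filter (fun x => x ≤ k) := by
    ext x
    simp only [Finset.mem_sdiff, Finset.mem_range, Finset.mem_filter, not_and]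
    exact and_congr_right fun hx => ⟨fun h h' => (h h').elim, fun h h' => h h' hx.le⟩
  have hcard := Finset.card_sdiff_add_card_eq_card (filter_le_subset_range hA)
  rw [Finset.card_range] at hcard
  rw [freePositions, Finset.card_union_of_disjoint,
    Finset.card_image_of_injective _ (add_left_injective (2 * m)), Nat.card_Ioo, hsdiff]
  · omega
  · simp only [Finset.disjoint_left, Finset.mem_Ioo, Finset.mem_image, not_exists]
    omega

lemma genus_withGaps (hkm : k < m) (hA : A ∈ AkSet k) (hT : T ⊆ freePositions k A m) :
    genus (withGaps k A m T) + A.card = m + k + 1 + T.card := by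
  rw [genus, withGaps, compl_compl, Set.ncard_coe_finset, Finset.card_union_of_disjoint]
  · have := card_forcedGaps hkm hA
    omega
  · exact (disjoint_forcedGaps_freePositions hkm).mono_right hT

lemma lt_of_mem_freePositions {x : ℕ} (hkm : k < m) (hx : x ∈ freePositions k A m) :
    m < x ∧ x < 2 * m + k := by
  rw [mem_freePositions] at hx
  omega

lemma isNumericalSemigroup_withGaps (hkm : k < m) (hA : A ∈ AkSet k)
    (hT : T ⊆ freePositions k A m) : IsNumericalSemigroup (withGaps k A m T) := by
  obtain ⟨-, -, hkA⟩ := mem_AkSet.1 hA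
  refine ⟨?_, fun a ha b hb => ?_, ?_⟩
  · refine mem_withGaps.2 ⟨fun h => ?_, fun h => ?_⟩
    · rw [mem_forcedGaps] at h
      omega
    · have := mem_freePositions.1 (hT h)
      omega
  · rcases Nat.eq_zero_or_pos a with rfl | ha₀
    · simpa using hb
    rcases Nat.eq_zero_or_pos b with rfl | hb₀
    · simpa using ha
    have ha' := (mem_withGaps.1 ha).1
    have hb' := (mem_withGaps.1 hb).1
    rw [mem_forcedGaps] at ha' hb'
    push Not at ha' hb'
    have ham : m ≤ a := ha'.1 ha₀
    have hbm : m ≤ b := hb'.1 hb₀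
    have hsum : a + b ≤ 2 * m + k → a + b - 2 * m ∈ A + A := fun hab => by
      have := Finset.add_mem_add (ha'.2.1 ham (by omega)) (hb'.2.1 hbm (by omega))
      rwa [show a - m + (b - m) = a + b - 2 * m by omega] at this
    refine mem_withGaps.2 ⟨fun h => ?_, fun h => ?_⟩
    · rw [mem_forcedGaps] at h
      have hab : a + b = 2 * m + k := by omega
      apply hkA
      simpa [hab] using hsum hab.le
    · have h' := mem_freePositions.1 (hT h)
      rcases h' with h' | h'
      · omega
      · exact h'.2.2 (hsum h'.2.1.le)
  · rw [withGaps, compl_compl]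
    exact Finset.finite_toSet _

lemma mult_withGaps (hkm : k < m) (hA : A ∈ AkSet k) (hT : T ⊆ freePositions k A m) :
    mult (withGaps k A m T) = m := by
  obtain ⟨-, h0, -⟩ := mem_AkSet.1 hA
  refine IsLeast.csInf_eq ⟨⟨mem_withGaps.2 ⟨fun h => ?_, fun h => ?_⟩, by omega⟩, ?_⟩
  · rw [mem_forcedGaps] at h
    have : m - m ∈ A := by simpa using h0
    rcases h with h | h | h
    · omega
    · exact h.2.2 this
    · omega
  · have := lt_of_mem_freePositions hkm (hT h)
    omega
  · rintro x ⟨hx, hx₀⟩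
    have := (mem_withGaps.1 hx).1
    rw [mem_forcedGaps] at this
    omega

lemma frob_withGaps (hkm : k < m) (hT : T ⊆ freePositions k A m) :
    frob (withGaps k A m T) = 2 * m + k := by
  refine IsGreatest.csSup_eq ⟨fun h => ?_, fun x hx => ?_⟩
  · exact (mem_withGaps.1 h).1 (mem_forcedGaps.2 (by omega))
  · rw [withGaps, compl_compl, Finset.mem_coe, Finset.mem_union, mem_forcedGaps] at hx
    rcases hx with hx | hx
    · omega
    · exact (lt_of_mem_freePositions hkm (hT hx)).2.le

lemma hasType_withGaps (hkm : k < m) (hA : A ∈ AkSet k) (hT : T ⊆ freePositions k A m) :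
    HasType (withGaps k A m T) k A := by
  rw [HasType, mult_withGaps hkm hA hT, frob_withGaps hkm hT]
  refine ⟨rfl, Set.ext fun x => ⟨?_, ?_⟩⟩
  · rintro ⟨hx, hmx, hxk⟩
    have := (mem_withGaps.1 hx).1
    rw [mem_forcedGaps] at this
    push Not at this
    exact ⟨x - m, this.2.1 hmx hxk, by simp [hmx]⟩
  · rintro ⟨a, ha, rfl⟩
    dsimp only
    have hak := Finset.mem_range.1 ((mem_AkSet.1 hA).1 ha)
    refine ⟨mem_withGaps.2 ⟨fun h => ?_, fun h => ?_⟩, by simp, by omega⟩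
    · rw [mem_forcedGaps, Nat.add_sub_cancel] at h
      rcases h with h | h | h
      · omega
      · exact h.2.2 ha
      · omega
    · have := mem_freePositions.1 (hT h)
      omega

lemma mem_iff_notMem_withGaps (hkm : k < m) (hT : T ⊆ freePositions k A m) (x : ℕ) :
    x ∈ T ↔ x ∈ freePositions k A m ∧ x ∉ withGaps k A m T := by
  refine ⟨fun h => ⟨hT h, fun h' => (mem_withGaps.1 h').2 h⟩, fun ⟨hx, h⟩ => ?_⟩
  by_contra hxT
  exact h (mem_withGaps.2
    ⟨Finset.disjoint_right.1 (disjoint_forcedGaps_freePositions hkm) hx, hxT⟩)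

end Construction

section Structure

variable {k : ℕ} {A : Finset ℕ} {Λ : Set ℕ}

lemma mem_of_frob_lt (hΛ : IsNumericalSemigroup Λ) {x : ℕ} (hx : frob Λ < x) : x ∈ Λ := by
  by_contra h
  exact absurd (le_csSup hΛ.2.2.bddAbove h) (not_le.2 hx)

lemma frob_notMem (hΛ : IsNumericalSemigroup Λ) (h : frob Λ ≠ 0) : frob Λ ∉ Λ := by
  have hne : Λᶜ.Nonempty := by
    by_contra hemp
    rw [Set.not_nonempty_iff_eq_empty] at hemp
    simp [frob, hemp] at h
  exact Nat.sSup_mem hne hΛ.2.2.bddAbove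

lemma mult_mem (hΛ : IsNumericalSemigroup Λ) : mult Λ ∈ Λ ∧ mult Λ ≠ 0 :=
  Nat.sInf_mem (s := {n | n ∈ Λ ∧ n ≠ 0})
    ⟨frob Λ + 1, mem_of_frob_lt hΛ (Nat.lt_succ_self _), Nat.succ_ne_zero _⟩

lemma mult_le {x : ℕ} (hx : x ∈ Λ) (hx₀ : x ≠ 0) : mult Λ ≤ x :=
  Nat.sInf_le (s := {n | n ∈ Λ ∧ n ≠ 0}) ⟨hx, hx₀⟩

lemma genus_lt_frob (hΛ : IsNumericalSemigroup Λ) (h : mult Λ ≤ frob Λ) :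
    genus Λ < frob Λ := by
  obtain ⟨hm, hm₀⟩ := mult_mem hΛ
  have hsub : Λᶜ ⊆ ↑((Finset.Icc 1 (frob Λ)).erase (mult Λ)) := fun x hx => by
    have h₀ : x ≠ 0 := fun h => hx (h ▸ hΛ.1)
    have hxm : x ≠ mult Λ := fun h => hx (h ▸ hm)
    have hle : x ≤ frob Λ := le_csSup hΛ.2.2.bddAbove hx
    exact Finset.mem_coe.2 (Finset.mem_erase.2 ⟨hxm, Finset.mem_Icc.2 ⟨by omega, hle⟩⟩)
  have := Set.ncard_le_ncard hsub (Finset.finite_toSet _)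
  rw [Set.ncard_coe_finset, Finset.card_erase_of_mem (Finset.mem_Icc.2 ⟨by omega, h⟩),
    Nat.card_Icc, Nat.add_sub_cancel] at this
  rw [genus]
  omega

lemma HasType.mem_iff (ht : HasType Λ k A) {x : ℕ} (h₁ : mult Λ ≤ x) (h₂ : x ≤ mult Λ + k) :
    x ∈ Λ ↔ x - mult Λ ∈ A := by
  have := Set.ext_iff.1 ht.2 x
  simp only [Set.mem_inter_iff, Set.mem_Icc, h₁, h₂, and_self, and_true, Set.mem_image,
    Finset.mem_coe] at this
  rw [this]
  constructor
  · rintro ⟨a, ha, rfl⟩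
    simpa using ha
  · exact fun h => ⟨_, h, by omega⟩

lemma HasType.exists_eq_withGaps (hΛ : IsNumericalSemigroup Λ) (ht : HasType Λ k A)
    (hA : A ∈ AkSet k) :
    ∃ T ⊆ freePositions k A (mult Λ), Λ = withGaps k A (mult Λ) T := by
  classical
  have hm₀ := (mult_mem hΛ).2
  have hfr : frob Λ = 2 * mult Λ + k := ht.1
  have hf : 2 * mult Λ + k ∉ Λ := hfr ▸ frob_notMem hΛ (by omega)
  refine ⟨_, Finset.filter_subset (fun x => x ∉ Λ) _, Set.ext fun x => ?_⟩
  rw [mem_withGaps, Finset.mem_filter, not_and_not_right]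
  refine ⟨fun hx => ⟨fun h => ?_, fun _ => hx⟩, fun ⟨h₁, h₂⟩ => ?_⟩
  · rw [mem_forcedGaps] at h
    rcases h with h | h | h
    · have := mult_le hx (by omega)
      omega
    · exact h.2.2 ((ht.mem_iff h.1 h.2.1).1 hx)
    · exact hf (h ▸ hx)
  · rw [mem_forcedGaps] at h₁
    push Not at h₁
    by_contra hx
    have hx₀ : x ≠ 0 := fun h => hx (h ▸ hΛ.1)
    have hmx := h₁.1 (by omega)
    have hxk : mult Λ + k < x := by
      by_contra hxk
      exact hx ((ht.mem_iff hmx (by omega)).2 (h₁.2.1 hmx (by omega)))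
    have hxf : x ≤ 2 * mult Λ + k := hfr ▸ le_csSup hΛ.2.2.bddAbove hx
    have hxf' := h₁.2.2
    refine hx (h₂ (mem_freePositions.2 ?_))
    by_cases hx2 : x < 2 * mult Λ
    · exact Or.inl ⟨hxk, hx2⟩
    refine Or.inr ⟨by omega, by omega, fun hmem => hx ?_⟩
    obtain ⟨a, ha, b, hb, hab⟩ := Finset.mem_add.1 hmem
    have key : ∀ c ∈ A, c + mult Λ ∈ Λ := fun c hc =>
      (ht.mem_iff (by omega) (by
        have := Finset.mem_range.1 ((mem_AkSet.1 hA).1 hc)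
        omega)).2 (by simpa using hc)
    have := hΛ.2.1 _ (key a ha) _ (key b hb)
    rwa [show a + mult Λ + (b + mult Λ) = x by omega] at this

lemma HasType.lt_mult (hΛ : IsNumericalSemigroup Λ) (ht : HasType Λ k A)
    (h : 3 * k ≤ genus Λ) : k < mult Λ := by
  have hfr : frob Λ = 2 * mult Λ + k := ht.1
  have := genus_lt_frob hΛ (by omega)
  omega

end Structure

lemma setOf_hasType_eq_image {g k : ℕ} (h : 3 * k ≤ g) {A : Finset ℕ} (hA : A ∈ AkSet k) :
    {Λ : Set ℕ | IsNumericalSemigroup Λ ∧ genus Λ = g ∧ HasType Λ k A} =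
      (fun p : (_ : ℕ) × Finset ℕ => withGaps k A p.1 p.2) ''
        ((Finset.Ioc k (g + A.card - k - 1)).sigma fun m =>
          (freePositions k A m).powersetCard (g + A.card - k - 1 - m) : Finset _) := by
  ext Λ
  simp only [Set.mem_ofPred_eq, Set.mem_image, Finset.mem_coe, Finset.mem_sigma, Finset.mem_Ioc,
    Finset.mem_powersetCard, Sigma.exists]
  constructor
  · rintro ⟨hΛ, hgen, ht⟩
    have hkm := ht.lt_mult hΛ (hgen ▸ h)
    obtain ⟨T, hT, heq⟩ := ht.exists_eq_withGaps hΛ hA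
    have hcard := genus_withGaps hkm hA hT
    rw [← heq] at hcard
    exact ⟨mult Λ, T, ⟨⟨hkm, by omega⟩, hT, by omega⟩, heq.symm⟩
  · rintro ⟨m, T, ⟨⟨hkm, hm⟩, hT, hcard⟩, rfl⟩
    have := genus_withGaps hkm hA hT
    exact ⟨isNumericalSemigroup_withGaps hkm hA hT, by omega, hasType_withGaps hkm hA hT⟩

lemma injOn_withGaps {k : ℕ} {A : Finset ℕ} (hA : A ∈ AkSet k) :
    Set.InjOn (fun p : (_ : ℕ) × Finset ℕ => withGaps k A p.1 p.2)
      {p | k < p.1 ∧ p.2 ⊆ freePositions k A p.1} := by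
  rintro ⟨m, T⟩ ⟨hkm, hT⟩ ⟨m', T'⟩ ⟨hkm', hT'⟩ heq
  dsimp only at hkm hT hkm' hT' heq
  obtain rfl : m = m' := by
    rw [← mult_withGaps hkm hA hT, heq, mult_withGaps hkm' hA hT']
  obtain rfl : T = T' := by
    ext x
    rw [mem_iff_notMem_withGaps hkm hT, heq, ← mem_iff_notMem_withGaps hkm hT']
  rfl

lemma sum_Ioc_choose_eq_fib {k s M : ℕ} (hsk : s ≤ k) (hM : 2 * k ≤ M) (hs : s < M) :
    ∑ m ∈ Finset.Ioc k M, (m - 1 - s).choose (M - m) = Nat.fib (M - s) := by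
  have hsub : Finset.Ioc k M ⊆ Finset.Ico (s + 1) (M + 1) := fun m hm => by
    rw [Finset.mem_Ioc] at hm
    exact Finset.mem_Ico.2 (by omega)
  rw [Finset.sum_subset hsub, Finset.sum_Ico_eq_sum_range,
    show M - s = M - s - 1 + 1 by omega, Nat.fib_succ_eq_sum_choose,
    Finset.Nat.sum_antidiagonal_eq_sum_range_succ_mk]
  · refine Finset.sum_congr (by congr 1; omega) fun i hi => ?_
    congr 1 <;> omega
  · intro m hm hm'
    rw [Finset.mem_Ico] at hm
    rw [Finset.mem_Ioc] at hm'
    exact Nat.choose_eq_zero_of_lt (by omega)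

/-- For positive integers `g, k` with `3k ≤ g` and `A ∈ 𝒜_k`, the number of
numerical semigroups with genus `g` and type `(A; k)` equals
`F_{g - |(A+A)∩[0,k]| + |A| - k - 1}`. -/
theorem statement10 (g k : ℕ) (hg : 0 < g) (hk : 0 < k) (h : 3 * k ≤ g)
    (A : Finset ℕ) (hA : A ∈ AkSet k) :
    {Λ : Set ℕ | IsNumericalSemigroup Λ ∧ genus Λ = g ∧ HasType Λ k A}.ncard =
      fibZ ((g : ℤ) - ((A + A).filter (fun x => x ≤ k)).card + A.card - k - 1) := by
  have hApos : 0 < A.card := Finset.card_pos.2 ⟨0, (mem_AkSet.1 hA).2.1⟩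
  have hs := Finset.card_le_card (filter_le_subset_range hA)
  rw [Finset.card_range] at hs
  rw [setOf_hasType_eq_image h hA, Set.InjOn.ncard_image, Set.ncard_coe_finset,
    Finset.card_sigma]
  · have hcard : ∀ m ∈ Finset.Ioc k (g + A.card - k - 1),
        ((freePositions k A m).powersetCard (g + A.card - k - 1 - m)).card =
          (m - 1 - ((A + A).filter (fun x => x ≤ k)).card).choose
            (g + A.card - k - 1 - m) := fun m hm => by
      have := card_freePositions (Finset.mem_Ioc.1 hm).1 hA
      rw [Finset.card_powersetCard]
      congr 1
      omega
    rw [Finset.sum_congr rfl hcard, sum_Ioc_choose_eq_fib hs (by omega) (by omega), fibZ,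
      if_pos (by omega)]
    congr 1
    omega
  · refine (injOn_withGaps hA).mono fun p hp => ?_
    rw [Finset.mem_coe, Finset.mem_sigma, Finset.mem_Ioc, Finset.mem_powersetCard] at hp
    exact ⟨hp.1.1, hp.2.1⟩
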